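/- For every even integer n ≥ 6, with a = σ_{n-3}·T·α₀·σ_{n-3}⁻¹ and b = T·σ_{n-1}⁻¹·α₂ in EM_n, the element y = σ₁σ₃σ₅⋯σ_{n-1} (the product of the σ_k over all odd indices k from 1 to n−1) belongs to the subgroup of EM_n generated by {a, b}. -/

import Mathlib

/-!
The extended mapping class group `EM n` of the `n`-punctured sphere, presented with
generators `σ₁, …, σ_{n-1}`, `T` and relations:
`T² = 1`; `(T σᵢ)² = 1`; `σᵢσⱼ = σⱼσᵢ` for `|i - j| ≥ 2`;
`σᵢσⱼσᵢ = σⱼσᵢσⱼ` for `|i - j| = 1`;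
`σ₁⋯σ_{n-1} σ_{n-1}⋯σ₁ = 1`; `(σ₁⋯σ_{n-1})ⁿ = 1`.
-/

namespace SphereEMCG

/-- Generators: `none` is the reflection `T`; `some i` is the half-twist `σ_{i+1}`. -/
abbrev Gen (n : ℕ) := Option (Fin (n - 1))

/-- The generator `T` as an element of the free group. -/
def Tf (n : ℕ) : FreeGroup (Gen n) := FreeGroup.of (none : Gen n)

/-- The generator `σ_i` (for `1 ≤ i ≤ n - 1`) as an element of the free group. -/
def σf (n : ℕ) (i : ℕ) : FreeGroup (Gen n) :=
  if h : 1 ≤ i ∧ i ≤ n - 1 then FreeGroup.of (some ⟨i - 1, by omega⟩) else 1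

/-- The word `σ_a σ_{a+1} ⋯ σ_b` in the free group. -/
def σfProd (n : ℕ) (a b : ℕ) : FreeGroup (Gen n) :=
  ((List.range' a (b + 1 - a)).map (σf n)).prod

/-- The word `σ_b σ_{b-1} ⋯ σ_a` in the free group. -/
def σfProdRev (n : ℕ) (a b : ℕ) : FreeGroup (Gen n) :=
  ((List.range' a (b + 1 - a)).reverse.map (σf n)).prod

/-- The defining relations of the extended mapping class group of the
`n`-punctured sphere. -/
def rels (n : ℕ) : Set (FreeGroup (Gen n)) :=
  { r | r = Tf n * Tf n
      ∨ (∃ i, 1 ≤ i ∧ i ≤ n - 1 ∧ r = (Tf n * σf n i) * (Tf n * σf n i))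
      ∨ (∃ i j, 1 ≤ i ∧ i ≤ n - 1 ∧ 1 ≤ j ∧ j ≤ n - 1 ∧ (i + 2 ≤ j ∨ j + 2 ≤ i) ∧
          r = σf n i * σf n j * (σf n j * σf n i)⁻¹)
      ∨ (∃ i j, 1 ≤ i ∧ i ≤ n - 1 ∧ 1 ≤ j ∧ j ≤ n - 1 ∧ (i + 1 = j ∨ j + 1 = i) ∧
          r = σf n i * σf n j * σf n i * (σf n j * σf n i * σf n j)⁻¹)
      ∨ r = σfProd n 1 (n - 1) * σfProdRev n 1 (n - 1)
      ∨ r = (σfProd n 1 (n - 1)) ^ n }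

/-- The extended mapping class group of the `n`-punctured sphere, by its
standard presentation. -/
abbrev EM (n : ℕ) := PresentedGroup (rels n)

/-- The orientation-reversing mapping class `T` in `EM n`. -/
def T (n : ℕ) : EM n := PresentedGroup.mk (rels n) (Tf n)

/-- The half-twist `σ_i` in `EM n`. -/
def σ (n : ℕ) (i : ℕ) : EM n := PresentedGroup.mk (rels n) (σf n i)

/-- `α₀ = σ₁ ⋯ σ_{n-1}` in `EM n`. -/
def α₀ (n : ℕ) : EM n := PresentedGroup.mk (rels n) (σfProd n 1 (n - 1))

/-- `α₂ = σ₁ ⋯ σ_{n-3} σ_{n-2}²` in `EM n`. -/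
def α₂ (n : ℕ) : EM n := PresentedGroup.mk (rels n) (σfProd n 1 (n - 2) * σf n (n - 2))

end SphereEMCG

namespace SphereEMCG

section Braid

variable {G : Type*} [Group G]

/-- If `x₀, x₁, x₂` are three consecutive translates of `s₀ s₂⁻¹ s₃⁻¹ s₂ s₁` under an operation that
shifts indices and inverts letters, then `s₀ s₂ s₄⁻¹` is a word in `x₀, x₁, x₂`. -/
theorem braid_word_eq {s₀ s₁ s₂ s₃ s₄ s₅ : G}
    (h02 : s₀ * s₂ = s₂ * s₀) (h03 : s₀ * s₃ = s₃ * s₀) (h04 : s₀ * s₄ = s₄ * s₀)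
    (h13 : s₁ * s₃ = s₃ * s₁) (h14 : s₁ * s₄ = s₄ * s₁) (h15 : s₁ * s₅ = s₅ * s₁)
    (h24 : s₂ * s₄ = s₄ * s₂) (h25 : s₂ * s₅ = s₅ * s₂)
    (h35 : s₃ * s₅ = s₅ * s₃)
    (b12 : s₁ * s₂ * s₁ = s₂ * s₁ * s₂) (b23 : s₂ * s₃ * s₂ = s₃ * s₂ * s₃)
    (b34 : s₃ * s₄ * s₃ = s₄ * s₃ * s₄)
    {x₀ x₁ x₂ : G} (hx₀ : x₀ = s₀ * s₂⁻¹ * s₃⁻¹ * s₂ * s₁)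
    (hx₁ : x₁ = s₁⁻¹ * s₃ * s₄ * s₃⁻¹ * s₂⁻¹) (hx₂ : x₂ = s₂ * s₄⁻¹ * s₅⁻¹ * s₄ * s₃) :
    x₁ * (x₁ * x₂)⁻¹ * x₂ * x₁⁻¹ * (x₀ * x₁) = s₀ * s₂ * s₄⁻¹ := by
  have e01 : x₀ * x₁ = s₀ * (s₃ * s₄ * s₂⁻¹ * s₃⁻¹ * s₂⁻¹) := by
    have k : s₃⁻¹ * s₂ * s₃ = s₂ * s₃ * s₂⁻¹ := by
      rw [eq_mul_inv_iff_mul_eq, mul_assoc, mul_assoc, inv_mul_eq_iff_eq_mul, ← mul_assoc,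
        ← mul_assoc, b23]
    have k' : s₂⁻¹ * s₄ = s₄ * s₂⁻¹ := (Commute.inv_left h24 : _)
    calc x₀ * x₁ = s₀ * s₂⁻¹ * (s₃⁻¹ * s₂ * s₃) * s₄ * s₃⁻¹ * s₂⁻¹ := by rw [hx₀, hx₁]; group
      _ = s₀ * s₃ * (s₂⁻¹ * s₄) * s₃⁻¹ * s₂⁻¹ := by rw [k]; group
      _ = _ := by rw [k']; group
  have e12 : x₁ * x₂ = s₁⁻¹ * (s₄⁻¹ * s₅⁻¹ * s₃ * s₄ * s₃) := by
    have k : s₃ * s₄ * s₃⁻¹ = s₄⁻¹ * s₃ * s₄ := by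
      rw [mul_inv_eq_iff_eq_mul, mul_assoc, mul_assoc, eq_inv_mul_iff_mul_eq, ← mul_assoc,
        ← mul_assoc, b34]
    have k' : s₃ * s₅⁻¹ = s₅⁻¹ * s₃ := (Commute.inv_right h35 : _)
    calc x₁ * x₂ = s₁⁻¹ * (s₃ * s₄ * s₃⁻¹) * s₄⁻¹ * s₅⁻¹ * s₄ * s₃ := by rw [hx₁, hx₂]; group
      _ = s₁⁻¹ * s₄⁻¹ * (s₃ * s₅⁻¹) * s₄ * s₃ := by rw [k]; group
      _ = _ := by rw [k']; group
  have e1 : x₁ * (s₃⁻¹ * s₄⁻¹ * s₃⁻¹) = s₁⁻¹ * s₂⁻¹ * s₃⁻¹ * s₄⁻¹ * s₃⁻¹ * s₂ := by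
    have k₁ : s₃⁻¹ * s₂⁻¹ * s₃⁻¹ = s₂⁻¹ * s₃⁻¹ * s₂⁻¹ := by
      simpa [mul_assoc] using congrArg (·⁻¹) b23.symm
    have k₂ : s₄ * s₃⁻¹ * s₄⁻¹ = s₃⁻¹ * s₄⁻¹ * s₃ := by
      rw [mul_inv_eq_iff_eq_mul, mul_assoc, mul_assoc, eq_inv_mul_iff_mul_eq,
        eq_inv_mul_iff_mul_eq, ← mul_assoc, ← mul_assoc, mul_inv_eq_iff_eq_mul, ← b34]
    have k₃ : s₃ * s₂⁻¹ * s₃⁻¹ = s₂⁻¹ * s₃⁻¹ * s₂ := by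
      rw [mul_inv_eq_iff_eq_mul, mul_assoc, mul_assoc, eq_inv_mul_iff_mul_eq,
        eq_inv_mul_iff_mul_eq, ← mul_assoc, ← mul_assoc, mul_inv_eq_iff_eq_mul, ← b23]
    have k₄ : s₄ * s₂⁻¹ = s₂⁻¹ * s₄ := (Commute.inv_right (Commute.symm h24) : _)
    have k₅ : s₂⁻¹ * s₄⁻¹ = s₄⁻¹ * s₂⁻¹ := (Commute.inv_inv h24 : _)
    calc x₁ * (s₃⁻¹ * s₄⁻¹ * s₃⁻¹)
        = s₁⁻¹ * s₃ * s₄ * (s₃⁻¹ * s₂⁻¹ * s₃⁻¹) * s₄⁻¹ * s₃⁻¹ := by rw [hx₁]; group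
      _ = s₁⁻¹ * s₃ * (s₄ * s₂⁻¹) * s₃⁻¹ * (s₂⁻¹ * s₄⁻¹) * s₃⁻¹ := by rw [k₁]; group
      _ = s₁⁻¹ * s₃ * s₂⁻¹ * (s₄ * s₃⁻¹ * s₄⁻¹) * s₂⁻¹ * s₃⁻¹ := by rw [k₄, k₅]; group
      _ = s₁⁻¹ * (s₃ * s₂⁻¹ * s₃⁻¹) * s₄⁻¹ * (s₃ * s₂⁻¹ * s₃⁻¹) := by rw [k₂]; group
      _ = s₁⁻¹ * s₂⁻¹ * s₃⁻¹ * s₂ * (s₄⁻¹ * s₂⁻¹) * s₃⁻¹ * s₂ := by rw [k₃]; group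
      _ = _ := by rw [← k₅]; group
  have e21 : s₅ * s₄ * s₁ * (x₂ * x₁⁻¹) = s₁ * s₂ * s₄ * s₃ * s₂ * s₃ * s₄⁻¹ * s₃⁻¹ * s₁ := by
    have k₁ : s₄ * (s₁ * s₂) = s₁ * s₂ * s₄ :=
      (Commute.mul_right (Commute.symm h14) (Commute.symm h24) : Commute s₄ (s₁ * s₂))
    have k₂ : s₅ * (s₁ * s₂) = s₁ * s₂ * s₅ :=
      (Commute.mul_right (Commute.symm h15) (Commute.symm h25) : Commute s₅ (s₁ * s₂))
    calc s₅ * s₄ * s₁ * (x₂ * x₁⁻¹)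
        = s₅ * (s₄ * (s₁ * s₂)) * s₄⁻¹ * s₅⁻¹ * s₄ * s₃ * s₂ * s₃ * s₄⁻¹ * s₃⁻¹ * s₁ := by
          rw [hx₁, hx₂]; group
      _ = s₅ * (s₁ * s₂) * s₅⁻¹ * s₄ * s₃ * s₂ * s₃ * s₄⁻¹ * s₃⁻¹ * s₁ := by rw [k₁]; group
      _ = _ := by rw [k₂]; group
  have e : x₁ * (x₁ * x₂)⁻¹ * x₂ * x₁⁻¹ = s₄⁻¹ * s₂ * (s₃ * s₂ * s₃) * s₄⁻¹ * s₃⁻¹ := by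
    have c13 : Commute s₁ s₃ := h13
    have c14 : Commute s₁ s₄ := h14
    have k₁ : s₃⁻¹ * s₄⁻¹ * s₃⁻¹ * s₁ = s₁ * (s₃⁻¹ * s₄⁻¹ * s₃⁻¹) :=
      ((c13.inv_right.mul_right c14.inv_right).mul_right c13.inv_right).eq.symm
    have k₂ : s₁ * (s₄ * s₃) = s₄ * s₃ * s₁ := c14.mul_right c13
    have k₃ : s₃ * s₄⁻¹ * s₃⁻¹ * s₁ = s₁ * (s₃ * s₄⁻¹ * s₃⁻¹) :=
      ((c13.mul_right c14.inv_right).mul_right c13.inv_right).eq.symm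
    have k₄ : s₃⁻¹ * s₄⁻¹ * s₃⁻¹ = s₄⁻¹ * s₃⁻¹ * s₄⁻¹ := by
      simpa [mul_assoc] using congrArg (·⁻¹) b34
    have k₅ : s₁ * s₄⁻¹ = s₄⁻¹ * s₁ := c14.inv_right
    have k₆ : s₂⁻¹ * s₄⁻¹ = s₄⁻¹ * s₂⁻¹ := (Commute.inv_inv h24 : _)
    calc x₁ * (x₁ * x₂)⁻¹ * x₂ * x₁⁻¹
        = x₁ * (s₃⁻¹ * s₄⁻¹ * s₃⁻¹) * (s₅ * s₄ * s₁ * (x₂ * x₁⁻¹)) := by rw [e12]; group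
      _ = s₁⁻¹ * s₂⁻¹ * s₃⁻¹ * s₄⁻¹ * s₃⁻¹ * (s₂ * s₁ * s₂) * s₄ * s₃ * s₂ * s₃ * s₄⁻¹ * s₃⁻¹
          * s₁ := by rw [e1, e21]; group
      _ = s₁⁻¹ * s₂⁻¹ * (s₃⁻¹ * s₄⁻¹ * s₃⁻¹ * s₁) * s₂ * (s₁ * (s₄ * s₃)) * s₂
          * (s₃ * s₄⁻¹ * s₃⁻¹ * s₁) := by rw [← b12]; group
      _ = s₁⁻¹ * s₂⁻¹ * s₁ * (s₃⁻¹ * s₄⁻¹ * s₃⁻¹) * (s₂ * s₄) * s₃ * (s₁ * s₂ * s₁)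
          * s₃ * s₄⁻¹ * s₃⁻¹ := by rw [k₁, k₂, k₃]; group
      _ = s₁⁻¹ * s₂⁻¹ * s₁ * s₄⁻¹ * s₃⁻¹ * (s₂ * s₃ * s₂) * s₁ * s₂ * s₃ * s₄⁻¹ * s₃⁻¹ := by
          rw [k₄, h24, b12]; group
      _ = s₁⁻¹ * s₂⁻¹ * (s₁ * s₄⁻¹) * s₂ * (s₁ * s₃) * s₂ * s₃ * s₄⁻¹ * s₃⁻¹ := by
          rw [b23, h13]; group
      _ = s₁⁻¹ * (s₂⁻¹ * s₄⁻¹) * (s₁ * s₂ * s₁) * s₃ * s₂ * s₃ * s₄⁻¹ * s₃⁻¹ := by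
          rw [k₅]; group
      _ = s₁⁻¹ * (s₄⁻¹ * s₁) * s₂ * s₃ * s₂ * s₃ * s₄⁻¹ * s₃⁻¹ := by rw [k₆, b12]; group
      _ = _ := by rw [← k₅]; group
  have c02 : Commute s₀ s₂ := h02
  have c03 : Commute s₀ s₃ := h03
  have c04 : Commute s₀ s₄ := h04
  have k : s₄⁻¹ * s₂ * (s₂ * s₃ * s₂) * s₄⁻¹ * s₃⁻¹ * s₀
      = s₀ * (s₄⁻¹ * s₂ * (s₂ * s₃ * s₂) * s₄⁻¹ * s₃⁻¹) :=
    ((((c04.inv_right.mul_right c02).mul_right ((c02.mul_right c03).mul_right c02)).mul_right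
      c04.inv_right).mul_right c03.inv_right).eq.symm
  have k' : s₂ * s₄⁻¹ = s₄⁻¹ * s₂ := (Commute.inv_right h24 : _)
  rw [e, e01, ← b23, ← mul_assoc, k, mul_assoc s₀ s₂, k']
  group

end Braid

section Shift

variable {G : Type*} [Group G]

theorem forall_int_of_iff_add_one {P : ℤ → Prop} {k₀ : ℤ} (h : ∀ k, P k ↔ P (k + 1))
    (h₀ : P k₀) (k : ℤ) : P k := by
  induction k using Int.inductionOn' (b := k₀) with
  | zero => exact h₀
  | succ k _ ih => exact (h k).1 ih
  | pred k _ ih => exact (h (k - 1)).2 (by simpa using ih)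

variable {R : G} {t : ℤ → G}

theorem commute_shift (hR : ∀ k, MulAut.conj R (t k) = (t (k + 1))⁻¹) (d : ℤ) {k₀ : ℤ}
    (h₀ : Commute (t k₀) (t (k₀ + d))) (k : ℤ) : Commute (t k) (t (k + d)) := by
  refine forall_int_of_iff_add_one (P := fun k => Commute (t k) (t (k + d))) (fun k => ?_) h₀ k
  rw [← Commute.inv_inv_iff (a := t (k + 1)), ← hR, add_right_comm k 1 d, ← hR]
  simp only [Commute, SemiconjBy, ← map_mul, EmbeddingLike.apply_eq_iff_eq]

theorem braid_shift (hR : ∀ k, MulAut.conj R (t k) = (t (k + 1))⁻¹) {k₀ : ℤ}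
    (h₀ : t k₀ * t (k₀ + 1) * t k₀ = t (k₀ + 1) * t k₀ * t (k₀ + 1)) (k : ℤ) :
    t k * t (k + 1) * t k = t (k + 1) * t k * t (k + 1) := by
  refine forall_int_of_iff_add_one
    (P := fun k => t k * t (k + 1) * t k = t (k + 1) * t k * t (k + 1)) (fun k => ?_) h₀ k
  rw [← (MulAut.conj R).injective.eq_iff, ← inv_inj]
  simp only [map_mul, hR, mul_inv_rev, inv_inv, mul_assoc]

/-- The product `t k * t (k + 2) * (t (k + 4))⁻¹` lies in every subgroup which contains the
shift `R` and one even translate of `t 0 * (t 2)⁻¹ * (t 3)⁻¹ * t 2 * t 1`. -/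
theorem mul_mul_inv_mem_of_shift {H : Subgroup G} (hR : ∀ k, MulAut.conj R (t k) = (t (k + 1))⁻¹)
    (hbraid : ∀ k, t k * t (k + 1) * t k = t (k + 1) * t k * t (k + 1))
    (h2 : ∀ k, Commute (t k) (t (k + 2))) (h3 : ∀ k, Commute (t k) (t (k + 3)))
    (h4 : ∀ k, Commute (t k) (t (k + 4))) (hRH : R ∈ H) {j₀ : ℤ}
    (hx : t (2 * j₀) * (t (2 * j₀ + 2))⁻¹ * (t (2 * j₀ + 3))⁻¹ * t (2 * j₀ + 2) * t (2 * j₀ + 1)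
      ∈ H) (k : ℤ) : t k * t (k + 2) * (t (k + 4))⁻¹ ∈ H := by
  have hconj : ∀ g, g ∈ H ↔ MulAut.conj R g ∈ H := fun g => by
    rw [MulAut.conj_apply, Subgroup.mul_mem_cancel_right _ (H.inv_mem hRH),
      Subgroup.mul_mem_cancel_left _ hRH]
  have hX : ∀ k, MulAut.conj R (t k * (t (k + 2))⁻¹ * (t (k + 3))⁻¹ * t (k + 2) * t (k + 1))
      = (t (k + 1))⁻¹ * t (k + 3) * t (k + 4) * (t (k + 3))⁻¹ * (t (k + 2))⁻¹ := fun k => by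
    simp only [map_mul, map_inv, hR, inv_inv, add_assoc, Int.reduceAdd]
  have hX' : ∀ k, MulAut.conj R
      ((t (k + 1))⁻¹ * t (k + 3) * t (k + 4) * (t (k + 3))⁻¹ * (t (k + 2))⁻¹)
      = t (k + 2) * (t (k + 4))⁻¹ * (t (k + 5))⁻¹ * t (k + 4) * t (k + 3) := fun k => by
    simp only [map_mul, map_inv, hR, inv_inv, add_assoc, Int.reduceAdd]
  have hXmem : ∀ j : ℤ, t (2 * j) * (t (2 * j + 2))⁻¹ * (t (2 * j + 3))⁻¹ * t (2 * j + 2)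
      * t (2 * j + 1) ∈ H := by
    refine forall_int_of_iff_add_one (fun j => ?_) hx
    rw [hconj, hX, hconj, hX', show 2 * (j + 1) = 2 * j + 2 by ring]
    simp only [add_assoc, Int.reduceAdd]
  have key : t 0 * t 2 * (t 4)⁻¹ ∈ H := by
    have m₀ := hXmem 0
    have m₂ := hXmem 1
    have m₁ := (hconj _).1 m₀
    rw [hX] at m₁
    norm_num at m₀ m₁ m₂
    have := braid_word_eq (h2 0) (h3 0) (h4 0) (h2 1) (h3 1) (h4 1) (h2 2) (h3 2) (h2 3)
      (hbraid 1) (hbraid 2) (hbraid 3) rfl rfl rfl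
    simp only [zero_add, Int.reduceAdd] at this
    rw [← this]
    exact H.mul_mem (H.mul_mem (H.mul_mem (H.mul_mem m₁ (H.inv_mem (H.mul_mem m₁ m₂))) m₂)
      (H.inv_mem m₁)) (H.mul_mem m₀ m₁)
  refine forall_int_of_iff_add_one (P := fun k => t k * t (k + 2) * (t (k + 4))⁻¹ ∈ H) (k₀ := 0)
    (fun k => ?_) (by simpa using key) k
  have e : MulAut.conj R (t k * t (k + 2) * (t (k + 4))⁻¹)
      = (t (k + 1) * t (k + 1 + 2) * (t (k + 1 + 4))⁻¹)⁻¹ := by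
    have c₁ := h2 (k + 1)
    have c₂ := h2 (k + 1 + 2)
    have c₃ := h4 (k + 1)
    rw [show k + 1 + 2 + 2 = k + 1 + 4 by ring] at c₂
    simp only [map_mul, map_inv, hR, inv_inv, add_right_comm k _ 1]
    rw [mul_inv_rev, mul_inv_rev, inv_inv, c₁.inv_inv.eq, (c₂.inv_left.mul_left c₃.inv_left).eq]
  rw [hconj, e, H.inv_mem_iff]

/-- Every `s` starts a sequence which `R` shifts and inverts; it has the period `n` if `n` is even
and `R ^ n = 1`. -/
theorem exists_shift_sequence (R s : G) {n : ℕ} (hn : Even n) (hRn : R ^ n = 1) :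
    ∃ t : ℤ → G, t 1 = s ∧ (∀ k, MulAut.conj R (t k) = (t (k + 1))⁻¹) ∧
      ∀ k, t (k + n) = t k := by
  let A : ℤ → G := fun k => MulAut.conj (R ^ (k - 1)) s
  have hA : ∀ k, MulAut.conj R (A k) = A (k + 1) := fun k => by
    simp only [A]
    rw [← MulAut.mul_apply, ← map_mul, ← zpow_one_add, add_sub_cancel_right, add_sub_cancel]
  refine ⟨fun k => if Odd k then A k else (A k)⁻¹, by simp [A], fun k => ?_, fun k => ?_⟩
  · by_cases hk : Odd k
    · have hk' : ¬ Odd (k + 1) := by grind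
      simp [hk, hk', hA]
    · have hk' : Odd (k + 1) := by grind
      simp only [hk, hk', if_true, if_false, map_inv, hA]
  · have hk : Odd (k + n) ↔ Odd k := by
      have : Even (n : ℤ) := by exact_mod_cast hn
      grind
    have hAk : A (k + n) = A k := by
      simp only [A]
      rw [add_sub_right_comm, zpow_add, zpow_natCast, hRn, mul_one]
    simp only [hk, hAk]

/-- The product of one period of a periodic commuting sequence `c` lies in every subgroup that
contains all the products `c k * c (k + 1) * (c (k + 2))⁻¹`. -/
theorem prod_mem_of_mul_mul_inv_mem {H : Subgroup G} {c : ℕ → G} {m : ℕ}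
    (h1 : ∀ k, Commute (c k) (c (k + 1))) (hc : ∀ k < m, Commute (c 1) (c k))
    (hm : c (m + 1) = c 1) (hH : ∀ k, c k * c (k + 1) * (c (k + 2))⁻¹ ∈ H) :
    ((List.range m).map c).prod ∈ H := by
  have h : ∀ k ≤ m, ((List.range k).map c).prod * c 1 * (c (k + 1))⁻¹ ∈ H := by
    intro k hk
    induction k with
    | zero => simp
    | succ k ih =>
      have := H.mul_mem (ih (by omega)) (hH k)
      rw [(h1 k).eq] at this
      rw [List.range_succ, List.map_append, List.prod_append]
      simp only [List.map_cons, List.map_nil, List.prod_singleton]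
      rw [mul_assoc _ (c k), ← (hc k hk).eq]
      convert this using 1
      group
  have := h m le_rfl
  rwa [hm, mul_inv_cancel_right] at this

end Shift
section Relations

variable (n : ℕ)

theorem T_mul_T : T n * T n = 1 :=
  PresentedGroup.one_of_mem (rels := rels n) (Or.inl rfl)

theorem T_inv : (T n)⁻¹ = T n :=
  inv_eq_of_mul_eq_one_left (T_mul_T n)

variable {n}

theorem conj_T_σ {i : ℕ} (h₁ : 1 ≤ i) (h₂ : i ≤ n - 1) :
    MulAut.conj (T n) (σ n i) = (σ n i)⁻¹ := by
  have h : T n * σ n i * (T n * σ n i) = 1 :=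
    PresentedGroup.one_of_mem (rels := rels n) (Or.inr (Or.inl ⟨i, h₁, h₂, rfl⟩))
  rw [MulAut.conj_apply, T_inv, eq_inv_iff_mul_eq_one, mul_assoc, h]

theorem commute_σ {i j : ℕ} (h₁ : 1 ≤ i) (hij : i + 2 ≤ j) (hj : j ≤ n - 1) :
    Commute (σ n i) (σ n j) := by
  have h : σ n i * σ n j * (σ n j * σ n i)⁻¹ = 1 :=
    PresentedGroup.one_of_mem (rels := rels n) (Or.inr (Or.inr (Or.inl
      ⟨i, j, h₁, by omega, by omega, hj, Or.inl hij, rfl⟩)))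
  exact mul_inv_eq_one.1 h

theorem braid_σ {i : ℕ} (h₁ : 1 ≤ i) (h₂ : i + 1 ≤ n - 1) :
    σ n i * σ n (i + 1) * σ n i = σ n (i + 1) * σ n i * σ n (i + 1) := by
  have h : σ n i * σ n (i + 1) * σ n i * (σ n (i + 1) * σ n i * σ n (i + 1))⁻¹ = 1 :=
    PresentedGroup.one_of_mem (rels := rels n) (Or.inr (Or.inr (Or.inr (Or.inl
      ⟨i, i + 1, h₁, by omega, by omega, h₂, Or.inl rfl, rfl⟩))))
  exact mul_inv_eq_one.1 h

theorem commute_σ_of_odd {i j : ℕ} (hi : Odd i) (hj : Odd j) (hi' : i ≤ n - 1) (hj' : j ≤ n - 1) :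
    Commute (σ n i) (σ n j) := by
  rcases lt_trichotomy i j with h | rfl | h
  · exact commute_σ hi.pos (by grind) hj'
  · exact Commute.refl _
  · exact (commute_σ hj.pos (by grind) hi').symm

variable (n)

/-- The product `σ₁ σ₂ ⋯ σ_k` in `EM n`. -/
def σProd (k : ℕ) : EM n := ((List.range' 1 k).map (σ n)).prod

theorem σProd_succ (k : ℕ) : σProd n (k + 1) = σProd n k * σ n (k + 1) := by
  simp [σProd, List.range'_1_concat, add_comm]

theorem mk_σfProd (k : ℕ) : PresentedGroup.mk (rels n) (σfProd n 1 k) = σProd n k := by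
  rw [σfProd, map_list_prod, List.map_map]
  rfl

theorem α₀_eq : α₀ n = σProd n (n - 1) := mk_σfProd n _

theorem α₂_eq : α₂ n = σProd n (n - 2) * σ n (n - 2) := by
  rw [α₂, map_mul, mk_σfProd, σ]

variable {n}

theorem commute_σProd_σ {k i : ℕ} (hk : k + 2 ≤ i) (hi : i ≤ n - 1) :
    Commute (σProd n k) (σ n i) := by
  refine Commute.list_prod_left _ _ fun g hg => ?_
  simp only [List.mem_map, List.mem_range'_1] at hg
  obtain ⟨j, hj, rfl⟩ := hg
  exact commute_σ hj.1 (by omega) hi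

theorem σProd_mul_σ {i k : ℕ} (h₁ : 1 ≤ i) (hik : i + 1 ≤ k) (hk : k ≤ n - 1) :
    σProd n k * σ n i = σ n (i + 1) * σProd n k := by
  induction k, hik using Nat.le_induction with
  | base =>
    obtain ⟨i, rfl⟩ := Nat.exists_eq_add_of_le' h₁
    rw [σProd_succ, σProd_succ, mul_assoc, mul_assoc, ← mul_assoc (σ n (i + 1)),
      braid_σ h₁ hk, ← mul_assoc, ← mul_assoc, (commute_σProd_σ (by omega) hk).eq]
    simp only [mul_assoc]
  | succ k hik ih =>
    rw [σProd_succ, mul_assoc, ← (commute_σ h₁ (by omega) hk).eq, ← mul_assoc,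
      ih (by omega), mul_assoc]

theorem conj_T_σProd {k : ℕ} (hk : k ≤ n - 1) :
    MulAut.conj (T n) (σProd n k) = (((List.range' 1 k).reverse.map (σ n)).prod)⁻¹ := by
  induction k with
  | zero => simp [σProd]
  | succ k ih =>
    rw [σProd_succ, map_mul, ih (by omega), conj_T_σ (by omega) hk, List.range'_1_concat]
    simp [add_comm]

theorem conj_T_α₀ : MulAut.conj (T n) (α₀ n) = α₀ n := by
  have h : PresentedGroup.mk (rels n) (σfProd n 1 (n - 1) * σfProdRev n 1 (n - 1)) = 1 :=
    PresentedGroup.one_of_mem (rels := rels n) (by simp [rels])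
  rw [map_mul, mk_σfProd, σfProdRev, map_list_prod, List.map_map, Nat.add_sub_cancel] at h
  rw [α₀_eq, conj_T_σProd le_rfl]
  exact (eq_inv_of_mul_eq_one_left h).symm

theorem commute_T_α₀ : Commute (T n) (α₀ n) := by
  have := conj_T_α₀ (n := n)
  rwa [MulAut.conj_apply, mul_inv_eq_iff_eq_mul] at this

theorem T_mul_α₀_pow (hn : Even n) : (T n * α₀ n) ^ n = 1 := by
  have h : α₀ n ^ n = 1 := by
    have : PresentedGroup.mk (rels n) (σfProd n 1 (n - 1) ^ n) = 1 :=
      PresentedGroup.one_of_mem (rels := rels n) (by simp [rels])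
    rwa [map_pow] at this
  obtain ⟨m, hm⟩ := hn
  rw [commute_T_α₀.mul_pow, h, mul_one, hm, ← two_mul, pow_mul, pow_two, T_mul_T, one_pow]

theorem conj_T_mul_α₀_σ {i : ℕ} (h₁ : 1 ≤ i) (h₂ : i + 1 ≤ n - 1) :
    MulAut.conj (T n * α₀ n) (σ n i) = (σ n (i + 1))⁻¹ := by
  rw [map_mul, MulAut.mul_apply, MulAut.conj_apply (α₀ n), α₀_eq, σProd_mul_σ h₁ h₂ le_rfl,
    mul_inv_cancel_right, conj_T_σ (by omega) h₂]

end Relations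

theorem T_mul_σ_inv_mul_α₂ {n : ℕ} (hn : 3 ≤ n) :
    T n * (σ n (n - 1))⁻¹ * α₂ n
      = T n * α₀ n * ((σ n (n - 2))⁻¹ * (σ n (n - 1))⁻¹ * σ n (n - 2)) := by
  obtain ⟨m, rfl⟩ := Nat.exists_eq_add_of_le' hn
  have h : α₀ (m + 3) * σ (m + 3) (m + 1) = σ (m + 3) (m + 2) * α₀ (m + 3) := by
    rw [α₀_eq, σProd_mul_σ (by omega) (by omega) le_rfl]
  have h' : (σ (m + 3) (m + 2))⁻¹ * α₀ (m + 3) = α₀ (m + 3) * (σ (m + 3) (m + 1))⁻¹ := by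
    rw [inv_mul_eq_iff_eq_mul, ← mul_assoc, ← h, mul_inv_cancel_right]
  have hα : α₂ (m + 3) = α₀ (m + 3) * (σ (m + 3) (m + 2))⁻¹ * σ (m + 3) (m + 1) := by
    rw [α₀_eq, show m + 3 - 1 = m + 1 + 1 from rfl, σProd_succ, mul_inv_cancel_right, α₂_eq]
    rfl
  rw [show m + 3 - 1 = m + 2 from rfl, show m + 3 - 2 = m + 1 from rfl, hα,
    mul_assoc (T (m + 3)), ← mul_assoc _ (α₀ (m + 3) * _), ← mul_assoc _ (α₀ (m + 3)), h']
  group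

end SphereEMCG

open SphereEMCG in
/-- For every even `n ≥ 6`, with `a = σ_{n-3} T α₀ σ_{n-3}⁻¹` and
`b = T σ_{n-1}⁻¹ α₂` in the extended mapping class group of the `n`-punctured
sphere, the element `y = σ₁ σ₃ σ₅ ⋯ σ_{n-1}` belongs to the subgroup generated
by `a` and `b`. -/
theorem y_mem_closure (n : ℕ) (hn : 6 ≤ n) (heven : Even n) :
    ((List.range (n / 2)).map (fun j => σ n (2 * j + 1))).prod ∈
      Subgroup.closure
        {σ n (n - 3) * T n * α₀ n * (σ n (n - 3))⁻¹,
         T n * (σ n (n - 1))⁻¹ * α₂ n} := by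
  obtain ⟨t, ht₁, hR, ht⟩ :=
    exists_shift_sequence (T n * α₀ n) (σ n 1) heven (T_mul_α₀_pow heven)
  have htσ : ∀ i : ℕ, 1 ≤ i → i ≤ n - 1 → t i = σ n i := by
    intro i hi
    induction i, hi using Nat.le_induction with
    | base => exact fun _ => ht₁
    | succ i hi ih =>
      intro h
      rw [← inv_inj, Nat.cast_add, Nat.cast_one, ← hR, ih (by omega), conj_T_mul_α₀_σ hi h]
  set K := Subgroup.closure {σ n (n - 3) * T n * α₀ n * (σ n (n - 3))⁻¹,
    T n * (σ n (n - 1))⁻¹ * α₂ n}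
  have ha : σ n (n - 3) * T n * α₀ n * (σ n (n - 3))⁻¹ ∈ K := Subgroup.subset_closure (by simp)
  have hb : T n * (σ n (n - 1))⁻¹ * α₂ n ∈ K := Subgroup.subset_closure (by simp)
  let H : Subgroup (EM n) := K.comap (MulAut.conj (σ n (n - 3))).toMonoidHom
  have hH : ∀ g, g ∈ H ↔ σ n (n - 3) * g * (σ n (n - 3))⁻¹ ∈ K := fun g => Iff.rfl
  have hRH : T n * α₀ n ∈ H := by rwa [hH, ← mul_assoc]
  obtain ⟨m, hm⟩ := heven
  have hcomm : ∀ d : ℕ, 2 ≤ d → d ≤ 4 → ∀ k : ℤ, Commute (t k) (t (k + d)) := by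
    intro d hd hd'
    refine commute_shift hR d (k₀ := 1) ?_
    have := htσ (1 + d) (by omega) (by omega)
    rw [Nat.cast_add, Nat.cast_one] at this
    rw [this, ht₁]
    exact commute_σ le_rfl (by omega) (by omega)
  have hbraid : ∀ k, t k * t (k + 1) * t k = t (k + 1) * t k * t (k + 1) := by
    refine braid_shift hR (k₀ := 1) ?_
    rw [show (1 + 1 : ℤ) = (2 : ℕ) from rfl, htσ 2 (by omega) (by omega), ht₁]
    exact braid_σ le_rfl (by omega)
  have hx : t (2 * (m - 2 : ℤ)) * (t (2 * (m - 2 : ℤ) + 2))⁻¹ * (t (2 * (m - 2 : ℤ) + 3))⁻¹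
      * t (2 * (m - 2 : ℤ) + 2) * t (2 * (m - 2 : ℤ) + 1) ∈ H := by
    rw [show 2 * (m - 2 : ℤ) = (n - 4 : ℕ) by omega,
      show ((n - 4 : ℕ) : ℤ) + 1 = (n - 3 : ℕ) by omega,
      show ((n - 4 : ℕ) : ℤ) + 2 = (n - 2 : ℕ) by omega,
      show ((n - 4 : ℕ) : ℤ) + 3 = (n - 1 : ℕ) by omega]
    rw [htσ _ (by omega) (by omega), htσ _ (by omega) (by omega), htσ _ (by omega) (by omega),
      htσ _ (by omega) (by omega), hH]
    have h := conj_T_mul_α₀_σ (n := n) (i := n - 4) (by omega) (by omega)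
    rw [show n - 4 + 1 = n - 3 by omega, MulAut.conj_apply] at h
    rw [T_mul_σ_inv_mul_α₂ (by omega)] at hb
    have h' : σ n (n - 4) = (T n * α₀ n)⁻¹ * (σ n (n - 3))⁻¹ * (T n * α₀ n) := by
      rw [← h]; group
    convert K.mul_mem (K.inv_mem ha) hb using 1
    rw [h']
    group
  have hv := mul_mul_inv_mem_of_shift hR hbraid (hcomm 2 (by omega) (by omega))
    (hcomm 3 (by omega) (by omega)) (hcomm 4 (by omega) (by omega)) hRH hx
  have hc : ∀ j < m, t (2 * j + 1) = σ n (2 * j + 1) := fun j hj => by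
    exact_mod_cast htσ (2 * j + 1) (by omega) (by omega)
  have hy : ((List.range m).map (fun j : ℕ => t (2 * j + 1))).prod ∈ H := by
    refine prod_mem_of_mul_mul_inv_mem (fun k => ?_) (fun k hk => ?_) ?_ fun k => ?_
    · convert hcomm 2 (by omega) (by omega) (2 * k + 1) using 2
      push_cast; ring
    · rw [hc 1 (by omega), hc k hk]
      exact commute_σ_of_odd (by decide) (by simp) (by omega) (by omega)
    · rw [← ht (2 * (1 : ℕ) + 1)]
      congr 1
      push_cast [hm]; ring
    · rw [show 2 * ((k + 1 : ℕ) : ℤ) + 1 = 2 * k + 1 + 2 by push_cast; ring,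
        show 2 * ((k + 2 : ℕ) : ℤ) + 1 = 2 * k + 1 + 4 by push_cast; ring]
      exact hv _
  rw [show n / 2 = m by omega]
  rw [List.map_congr_left (fun j hj => hc j (List.mem_range.1 hj)), hH] at hy
  have hyσ : Commute (σ n (n - 3)) ((List.range m).map (fun j => σ n (2 * j + 1))).prod := by
    refine Commute.list_prod_right _ _ fun g hg => ?_
    simp only [List.mem_map, List.mem_range] at hg
    obtain ⟨j, hj, rfl⟩ := hg
    exact commute_σ_of_odd (by grind) (by simp) (by omega) (by omega)
  rwa [hyσ.eq, mul_inv_cancel_right] at hy
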